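/- arXiv:math/0408065 — 7 statements merged into one kernel-verified Lean document; each statement's English description precedes it below -/
import Mathlib

section
/- Let p be an odd prime and D a negative integer with D ≡ 0 or 1 (mod 4), p ∣ D and p² ∤ D. Let a, b, c be integers with a > 0 and b² − 4ac = D, let δ = i·√|D|, τ = (−b + δ)/(2a), and let L be the additive subgroup of ℂ generated by 1 and τ. Since δ·L ⊆ L, multiplication by δ induces an additive group endomorphism φ of ℂ/L. Then there is exactly one additive subgroup H of ℂ/L of cardinality p such that H is contained in the kernel of φ (equivalently: exactly one p-torsion subgroup of ℂ/L is annihilated by the ideal 𝔭 = (p, √D) of the order of discriminant D). -/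
/-- Modulo an odd prime `p` exactly dividing `b ^ 2 - 4 * a * c`, the kernel of the matrix
`!![b, -2 * c; 2 * a, -b]` is a line. -/
theorem exists_generator_ker_mod_prime {p : ℕ} (hp : p.Prime) (hodd : Odd p) {a b c : ℤ}
    (h1 : (p : ℤ) ∣ b ^ 2 - 4 * a * c) (h2 : ¬ (p : ℤ) ^ 2 ∣ b ^ 2 - 4 * a * c) :
    ∃ u v : ℤ, ¬ ((p : ℤ) ∣ u ∧ (p : ℤ) ∣ v) ∧
      (p : ℤ) ∣ b * u - 2 * c * v ∧ (p : ℤ) ∣ 2 * a * u - b * v ∧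
      ∀ x y : ℤ, (p : ℤ) ∣ b * x - 2 * c * y → (p : ℤ) ∣ 2 * a * x - b * y →
        ∃ n : ℤ, (p : ℤ) ∣ x - n * u ∧ (p : ℤ) ∣ y - n * v := by
  have hpp : Prime (p : ℤ) := Nat.prime_iff_prime_int.mp hp
  have hp2 : ¬ (p : ℤ) ∣ 2 := by
    intro h
    have h' : p ∣ 2 := by exact_mod_cast h
    have := (Nat.prime_dvd_prime_iff_eq hp Nat.prime_two).mp h'
    subst this
    exact absurd hodd (by decide)
  by_cases hpa : (p : ℤ) ∣ a
  · have hpb : (p : ℤ) ∣ b := by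
      refine hpp.dvd_of_dvd_pow (n := 2) ?_
      have := dvd_add h1 (hpa.mul_left (4 * c))
      ring_nf at this
      exact this
    have hpc : ¬ (p : ℤ) ∣ c := by
      intro hpc
      apply h2
      obtain ⟨a', rfl⟩ := hpa
      obtain ⟨b', rfl⟩ := hpb
      obtain ⟨c', rfl⟩ := hpc
      exact ⟨b' ^ 2 - 4 * a' * c', by ring⟩
    refine ⟨1, 0, fun h => hpp.not_isUnit (isUnit_of_dvd_one h.1), by simpa using hpb,
      by simpa using hpa.mul_left 2, fun x y hx _ => ⟨x, by simp, ?_⟩⟩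
    have h3 : (p : ℤ) ∣ 2 * c * y := by
      have := dvd_sub (hpb.mul_right x) hx
      simpa using this
    rcases hpp.dvd_or_dvd h3 with h | h
    · rcases hpp.dvd_or_dvd h with h | h
      · exact absurd h hp2
      · exact absurd h hpc
    · simpa using h
  · have hp2a : ¬ (p : ℤ) ∣ 2 * a := fun h => (hpp.dvd_or_dvd h).elim hp2 hpa
    refine ⟨b, 2 * a, fun h => hp2a h.2, ?_, Dvd.intro 0 (by ring), fun x y _ hy => ?_⟩
    · rwa [show b * b - 2 * c * (2 * a) = b ^ 2 - 4 * a * c by ring]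
    · have hco : IsCoprime (p : ℤ) (2 * a) := (hpp.coprime_iff_not_dvd).mpr hp2a
      obtain ⟨r, s, hrs⟩ := hco
      have hyn : (p : ℤ) ∣ y - s * y * (2 * a) := ⟨r * y, by linear_combination -y * hrs⟩
      refine ⟨s * y, ?_, hyn⟩
      have h4 : (p : ℤ) ∣ 2 * a * (x - s * y * b) := by
        rw [show 2 * a * (x - s * y * b) = 2 * a * x - b * y + b * (y - s * y * (2 * a)) by ring]
        exact dvd_add hy (hyn.mul_left b)
      exact (hpp.dvd_or_dvd h4).resolve_left hp2a

theorem int_eq_of_add_mul_eq {τ : ℂ} (hτ : τ.im ≠ 0) {x y x' y' : ℤ}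
    (h : (x : ℂ) + y * τ = x' + y' * τ) : x = x' ∧ y = y' := by
  have hy : y = y' := by
    have := congrArg Complex.im h
    simp only [Complex.add_im, Complex.intCast_im, Complex.mul_im, Complex.intCast_re,
      zero_mul, add_zero, zero_add] at this
    exact_mod_cast mul_right_cancel₀ hτ this
  subst hy
  exact ⟨by exact_mod_cast add_right_cancel h, rfl⟩

theorem stmt_1 (p : ℕ) (hp : p.Prime) (hodd : Odd p)
    (D : ℤ) (hDneg : D < 0) (hDmod : D % 4 = 0 ∨ D % 4 = 1)
    (hpD : (p : ℤ) ∣ D) (hp2D : ¬ ((p : ℤ) ^ 2 ∣ D))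
    (a b c : ℤ) (ha : 0 < a) (hD : b ^ 2 - 4 * a * c = D)
    (δ τ : ℂ) (hδ : δ = Complex.I * Real.sqrt |(D : ℝ)|)
    (hτ : τ = (-(b : ℂ) + δ) / (2 * (a : ℂ)))
    (L : AddSubgroup ℂ) (hL : L = AddSubgroup.closure {1, τ}) :
    ∃! H : AddSubgroup (ℂ ⧸ L), Nat.card H = p ∧
      ∀ z : ℂ, (QuotientAddGroup.mk z : ℂ ⧸ L) ∈ H →
        (QuotientAddGroup.mk (δ * z) : ℂ ⧸ L) = 0 := by
  have hmem : ∀ z, z ∈ L ↔ ∃ x y : ℤ, (x : ℂ) + y * τ = z := by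
    intro z
    rw [hL, AddSubgroup.mem_closure_pair]
    simp
  have haC : (a : ℂ) ≠ 0 := by exact_mod_cast ha.ne'
  have hpC : (p : ℂ) ≠ 0 := by exact_mod_cast hp.ne_zero
  have hDR : (D : ℝ) < 0 := by exact_mod_cast hDneg
  have hδ2 : δ ^ 2 = D := by
    rw [hδ, mul_pow, Complex.I_sq, ← Complex.ofReal_pow, Real.sq_sqrt (abs_nonneg _),
      abs_of_neg hDR]
    simp
  have hδτ : δ = 2 * a * τ + b := by
    rw [hτ]
    field_simp
    ring
  have hτim : τ.im ≠ 0 := by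
    intro h0
    have h1 : δ.im = 0 := by
      rw [hδτ]
      simp [h0]
    rw [hδ] at h1
    simp only [Complex.I_mul_im, Complex.ofReal_re] at h1
    rw [Real.sqrt_eq_zero (abs_nonneg _), abs_eq_zero] at h1
    exact hDR.ne h1
  have hquad : δ * τ = -b * τ - 2 * c := by
    have hDC : (b : ℂ) ^ 2 - 4 * a * c = D := by exact_mod_cast hD
    have h2a : (2 * a : ℂ) ≠ 0 := mul_ne_zero two_ne_zero haC
    apply mul_left_cancel₀ h2a
    linear_combination hδ2 - hDC - (δ + b) * hδτ
  have hmul : ∀ x y : ℤ, δ * ((x : ℂ) + y * τ) =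
      ((b * x - 2 * c * y : ℤ) : ℂ) + ((2 * a * x - b * y : ℤ) : ℂ) * τ := by
    intro x y
    push_cast
    linear_combination (x : ℂ) * hδτ + (y : ℂ) * hquad
  have hdiv : ∀ x y : ℤ, ((x : ℂ) + y * τ) / p ∈ L ↔ (p : ℤ) ∣ x ∧ (p : ℤ) ∣ y := by
    intro x y
    rw [hmem]
    constructor
    · rintro ⟨m, n, h⟩
      rw [eq_div_iff hpC] at h
      have h' : ((p * m : ℤ) : ℂ) + ((p * n : ℤ) : ℂ) * τ = x + y * τ := by
        push_cast
        linear_combination h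
      obtain ⟨h1, h2⟩ := int_eq_of_add_mul_eq hτim h'
      exact ⟨⟨m, h1.symm⟩, ⟨n, h2.symm⟩⟩
    · rintro ⟨⟨m, rfl⟩, ⟨n, rfl⟩⟩
      refine ⟨m, n, ?_⟩
      push_cast
      field_simp
  have hδdiv : ∀ x y : ℤ, δ * (((x : ℂ) + y * τ) / p) ∈ L ↔
      (p : ℤ) ∣ b * x - 2 * c * y ∧ (p : ℤ) ∣ 2 * a * x - b * y := by
    intro x y
    rw [← mul_div_assoc, hmul, hdiv]
  obtain ⟨u, v, hne, hu, hv, hgen⟩ :=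
    exists_generator_ker_mod_prime hp hodd (hD ▸ hpD) (hD ▸ hp2D)
  have hδL : ∀ l ∈ L, δ * l ∈ L := by
    intro l hl
    obtain ⟨x, y, rfl⟩ := (hmem l).mp hl
    rw [hmul]
    exact (hmem _).mpr ⟨_, _, rfl⟩
  set g : ℂ := ((u : ℂ) + v * τ) / p with hg
  have hcard : Nat.card (AddSubgroup.zmultiples (QuotientAddGroup.mk g : ℂ ⧸ L)) = p := by
    rw [Nat.card_zmultiples]
    have : Fact p.Prime := ⟨hp⟩
    apply addOrderOf_eq_prime
    · rw [← QuotientAddGroup.mk_nsmul, QuotientAddGroup.eq_zero_iff, hmem]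
      refine ⟨u, v, ?_⟩
      rw [hg, nsmul_eq_mul]
      field_simp
    · rw [Ne, QuotientAddGroup.eq_zero_iff, hdiv]
      exact hne
  refine ⟨AddSubgroup.zmultiples (QuotientAddGroup.mk g : ℂ ⧸ L), ⟨hcard, ?_⟩, ?_⟩
  · intro z hz
    obtain ⟨n, hn⟩ := AddSubgroup.mem_zmultiples_iff.mp hz
    rw [← QuotientAddGroup.mk_zsmul, QuotientAddGroup.eq] at hn
    rw [QuotientAddGroup.eq_zero_iff]
    have hsplit : δ * z = n • (δ * g) + δ * (-(n • g) + z) := by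
      simp only [zsmul_eq_mul]
      ring
    rw [hsplit]
    exact L.add_mem (L.zsmul_mem ((hδdiv u v).mpr ⟨hu, hv⟩) n) (hδL _ hn)
  · rintro H ⟨hH, hker⟩
    have hle : H ≤ AddSubgroup.zmultiples (QuotientAddGroup.mk g : ℂ ⧸ L) := by
      intro h hh
      obtain ⟨z, rfl⟩ := QuotientAddGroup.mk_surjective h
      have hpz : (p : ℂ) * z ∈ L := by
        rw [← nsmul_eq_mul, ← QuotientAddGroup.eq_zero_iff, QuotientAddGroup.mk_nsmul, ← hH]
        exact congrArg Subtype.val (card_nsmul_eq_zero' (x := (⟨_, hh⟩ : H)))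
      obtain ⟨x, y, hxy⟩ := (hmem _).mp hpz
      have hz : z = ((x : ℂ) + y * τ) / p := by
        rw [hxy]
        field_simp
      have hδz := (QuotientAddGroup.eq_zero_iff _).mp (hker z hh)
      rw [hz, hδdiv] at hδz
      obtain ⟨n, hn⟩ := hgen x y hδz.1 hδz.2
      refine AddSubgroup.mem_zmultiples_iff.mpr ⟨n, ?_⟩
      rw [← QuotientAddGroup.mk_zsmul, QuotientAddGroup.eq]
      convert (hdiv _ _).mpr hn using 1
      rw [hz, hg, zsmul_eq_mul]
      push_cast
      ring
    have : Finite (AddSubgroup.zmultiples (QuotientAddGroup.mk g : ℂ ⧸ L)) :=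
      Nat.finite_of_card_ne_zero (by rw [hcard]; exact hp.ne_zero)
    exact AddSubgroup.eq_of_le_of_card_ge hle (by rw [hcard, hH])
end

section
/- Let p be an odd prime and D a negative integer with D ≡ 0 or 1 (mod 4), p ∣ D and p² ∤ D. Let a, b, c be integers with a > 0 and b² − 4ac = D, let δ = i·√|D|, τ = (−b + δ)/(2a), and let L be the additive subgroup of ℂ generated by 1 and τ. Then: (1) δ·(1/p) ∈ L if and only if p ∣ a; and (2) for every integer k, δ·((τ + k)/p) ∈ L if and only if p ∤ a and 2ak ≡ b (mod p). -/
/-- Membership in the lattice `ℤ + ℤτ` of a fraction of one of its elements. -/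
lemma div_mem_closure_one_tau_iff {τ : ℂ} (hτ : τ.im ≠ 0) {p : ℤ} (hp : p ≠ 0) (m n : ℤ) :
    ((m : ℂ) + n * τ) / p ∈ AddSubgroup.closure ({1, τ} : Set ℂ) ↔ p ∣ m ∧ p ∣ n := by
  have hpC : (p : ℂ) ≠ 0 := Int.cast_ne_zero.mpr hp
  rw [AddSubgroup.mem_closure_pair]
  constructor
  · rintro ⟨x, y, h⟩
    rw [eq_div_iff hpC, zsmul_eq_mul, zsmul_eq_mul, mul_one] at h
    have him := congrArg Complex.im h
    have hre := congrArg Complex.re h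
    simp only [Complex.add_im, Complex.mul_im, Complex.add_re, Complex.mul_re, Complex.intCast_re,
      Complex.intCast_im, mul_zero, zero_mul, add_zero, zero_add, sub_zero] at him hre
    have hn : (y * p : ℝ) = n := mul_right_cancel₀ hτ (by linarith)
    have hm : (x * p : ℝ) = m := by rw [← hn] at hre; linarith
    exact ⟨⟨x, by rw [mul_comm]; exact_mod_cast hm.symm⟩,
      ⟨y, by rw [mul_comm]; exact_mod_cast hn.symm⟩⟩
  · rintro ⟨⟨x, rfl⟩, ⟨y, rfl⟩⟩
    refine ⟨x, y, ?_⟩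
    rw [zsmul_eq_mul, zsmul_eq_mul]
    push_cast
    field_simp

theorem stmt_2 (p : ℕ) (hp : p.Prime) (hodd : Odd p)
    (D : ℤ) (hDneg : D < 0) (hDmod : D % 4 = 0 ∨ D % 4 = 1)
    (hpD : (p : ℤ) ∣ D) (hp2D : ¬ ((p : ℤ) ^ 2 ∣ D))
    (a b c : ℤ) (ha : 0 < a) (hD : b ^ 2 - 4 * a * c = D)
    (δ τ : ℂ) (hδ : δ = Complex.I * Real.sqrt |(D : ℝ)|)
    (hτ : τ = (-(b : ℂ) + δ) / (2 * (a : ℂ)))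
    (L : AddSubgroup ℂ) (hL : L = AddSubgroup.closure {1, τ}) :
    (δ * (1 / (p : ℂ)) ∈ L ↔ (p : ℤ) ∣ a) ∧
    (∀ k : ℤ, δ * ((τ + (k : ℂ)) / (p : ℂ)) ∈ L ↔
      (¬ (p : ℤ) ∣ a ∧ 2 * a * k ≡ b [ZMOD (p : ℤ)])) := by
  have hpr : Prime (p : ℤ) := Nat.prime_iff_prime_int.mp hp
  have haC : (a : ℂ) ≠ 0 := Int.cast_ne_zero.mpr ha.ne'
  have hDR : (D : ℝ) < 0 := Int.cast_lt_zero.mpr hDneg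
  have hδsq : δ ^ 2 = D := by
    rw [hδ, mul_pow, Complex.I_sq, ← Complex.ofReal_pow, Real.sq_sqrt (abs_nonneg _),
      abs_of_neg hDR]
    push_cast
    ring
  have hδτ : δ = b + 2 * a * τ := by
    rw [hτ]
    field_simp
    ring
  have hδmul : δ * τ = -2 * c - b * τ := by
    have hDC : (b : ℂ) ^ 2 - 4 * a * c = D := by exact_mod_cast hD
    have h : (2 * a : ℂ) * (δ * τ) = 2 * a * (-2 * c - b * τ) := by
      linear_combination (-δ - b) * hδτ + hδsq - hDC
    exact mul_left_cancel₀ (mul_ne_zero two_ne_zero haC) h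
  have him : τ.im ≠ 0 := by
    intro h0
    have h := congrArg Complex.im hδτ
    rw [hδ] at h
    simp [h0] at h
    exact hDneg.ne h
  have htwo : ¬ (p : ℤ) ∣ 2 := by
    intro h
    have h2 : p = 2 := (Nat.prime_dvd_prime_iff_eq hp Nat.prime_two).mp (by exact_mod_cast h)
    rw [h2] at hodd
    exact absurd hodd (by decide)
  have hb : (p : ℤ) ∣ a → (p : ℤ) ∣ b := fun h ↦ by
    have hb2 : (p : ℤ) ∣ b ^ 2 := by
      rw [show b ^ 2 = D + a * (4 * c) by rw [← hD]; ring]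
      exact dvd_add hpD (h.mul_right _)
    exact hpr.dvd_of_dvd_pow hb2
  subst hL
  constructor
  · rw [show δ * (1 / (p : ℂ)) = ((b : ℂ) + (2 * a : ℤ) * τ) / (p : ℤ) by
      rw [hδτ]; push_cast; ring, div_mem_closure_one_tau_iff him hpr.ne_zero]
    exact ⟨fun h ↦ (hpr.dvd_or_dvd h.2).resolve_left htwo, fun h ↦ ⟨hb h, h.mul_left _⟩⟩
  · intro k
    rw [show δ * ((τ + (k : ℂ)) / (p : ℂ)) =
        (((k * b - 2 * c : ℤ) : ℂ) + (2 * a * k - b : ℤ) * τ) / (p : ℤ) by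
      rw [mul_div_assoc', mul_add, hδmul, hδτ]; push_cast; ring,
      div_mem_closure_one_tau_iff him hpr.ne_zero]
    constructor
    · rintro ⟨h1, h2⟩
      refine ⟨fun h ↦ hp2D ?_, (Int.modEq_iff_dvd.mpr h2).symm⟩
      have hc : (p : ℤ) ∣ c := by
        have h2c : (p : ℤ) ∣ 2 * c := by
          have := dvd_sub ((hb h).mul_left k) h1
          rwa [sub_sub_cancel] at this
        exact (hpr.dvd_or_dvd h2c).resolve_left htwo
      rw [← hD, mul_assoc]
      refine dvd_sub (pow_dvd_pow_of_dvd (hb h) 2) ?_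
      rw [sq]
      exact (mul_dvd_mul h hc).mul_left 4
    · rintro ⟨hna, hk⟩
      have h2 : (p : ℤ) ∣ 2 * a * k - b := Int.modEq_iff_dvd.mp hk.symm
      refine ⟨?_, h2⟩
      have h : (p : ℤ) ∣ 2 * a * (k * b - 2 * c) := by
        rw [show 2 * a * (k * b - 2 * c) = (2 * a * k - b) * b + D by rw [← hD]; ring]
        exact dvd_add (h2.mul_right b) hpD
      exact (hpr.dvd_or_dvd h).resolve_left fun h' ↦ (hpr.dvd_or_dvd h').elim htwo hna
end

section
/- Let p and ℓ be primes with p ≡ 1 (mod 4), ℓ ≡ 3 (mod 4), and −p a square in ℤ/ℓℤ. Then the Diophantine equation p·x² + ℓ·y² = z² has no integer solutions (x, y, z) other than x = y = z = 0. -/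
/-- If `-a` is a nonzero square modulo a prime `q ≡ 3 (mod 4)`, then `a` is not a square
modulo `q`. -/
theorem ZMod.not_isSquare_of_isSquare_neg {q : ℕ} [Fact q.Prime] (hq : q % 4 = 3)
    {a : ZMod q} (ha : a ≠ 0) (hneg : IsSquare (-a)) : ¬IsSquare a := by
  intro h
  refine ZMod.exists_sq_eq_neg_one_iff.mp ?_ hq
  have hdiv := hneg.div h
  rwa [neg_div, div_self ha] at hdiv

/-- If `a` is not a square modulo `q`, then any solution of `a * x ^ 2 = z ^ 2` modulo `q`
is trivial. -/
theorem dvd_and_dvd_of_mul_sq_eq_sq {q : ℕ} [Fact q.Prime] {a x z : ℤ}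
    (ha : ¬IsSquare (a : ZMod q)) (h : (a : ZMod q) * (x : ZMod q) ^ 2 = (z : ZMod q) ^ 2) :
    (q : ℤ) ∣ x ∧ (q : ℤ) ∣ z := by
  simp only [← ZMod.intCast_zmod_eq_zero_iff_dvd]
  have hx : (x : ZMod q) = 0 := by
    by_contra hx
    refine ha ⟨(z : ZMod q) / x, ?_⟩
    field_simp
    exact h
  refine ⟨hx, ?_⟩
  rw [hx] at h
  simpa using h.symm

/-- If `a` is not a square modulo the prime `q`, then the ternary form
`a * x ^ 2 + q * y ^ 2 - z ^ 2` is anisotropic. -/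
theorem eq_zero_of_mul_sq_add_prime_mul_sq_eq_sq {q : ℕ} [hq : Fact q.Prime] {a : ℤ}
    (ha : ¬IsSquare (a : ZMod q)) (x y z : ℤ) (h : a * x ^ 2 + q * y ^ 2 = z ^ 2) :
    x = 0 ∧ y = 0 ∧ z = 0 := by
  induction hn : x.natAbs + y.natAbs + z.natAbs using Nat.strong_induction_on
    generalizing x y z with
  | _ n ih =>
  by_cases hn0 : n = 0
  · omega
  have hq0 : (q : ℤ) ≠ 0 := by exact_mod_cast hq.out.ne_zero
  have hmod : (a : ZMod q) * (x : ZMod q) ^ 2 = (z : ZMod q) ^ 2 := by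
    simpa using congrArg (Int.cast : ℤ → ZMod q) h
  obtain ⟨⟨x, rfl⟩, ⟨z, rfl⟩⟩ := dvd_and_dvd_of_mul_sq_eq_sq ha hmod
  have hy : y ^ 2 = q * (z ^ 2 - a * x ^ 2) := by
    apply mul_left_cancel₀ hq0
    linear_combination h
  obtain ⟨y, rfl⟩ := (Nat.prime_iff_prime_int.mp hq.out).dvd_of_dvd_pow ⟨_, hy⟩
  have h' : a * x ^ 2 + q * y ^ 2 = z ^ 2 := by
    apply mul_left_cancel₀ (pow_ne_zero 2 hq0)
    linear_combination h
  simp only [Int.natAbs_mul, Int.natAbs_natCast, ← mul_add] at hn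
  have hlt : x.natAbs + y.natAbs + z.natAbs < n := by
    have := hq.out.two_le
    rw [← hn] at hn0 ⊢
    have := Nat.pos_of_ne_zero (right_ne_zero_of_mul hn0)
    nlinarith
  obtain ⟨rfl, rfl, rfl⟩ := ih _ hlt x y z h' rfl
  simp

theorem stmt_3 (p ℓ : ℕ) (hp : p.Prime) (hl : ℓ.Prime)
    (hp4 : p % 4 = 1) (hl4 : ℓ % 4 = 3)
    (hsq : IsSquare (-(p : ZMod ℓ))) :
    ∀ x y z : ℤ, (p : ℤ) * x ^ 2 + (ℓ : ℤ) * y ^ 2 = z ^ 2 →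
      x = 0 ∧ y = 0 ∧ z = 0 := by
  have : Fact p.Prime := ⟨hp⟩
  have : Fact ℓ.Prime := ⟨hl⟩
  have hne : ℓ ≠ p := by
    rintro rfl
    omega
  apply eq_zero_of_mul_sq_add_prime_mul_sq_eq_sq
  rw [Int.cast_natCast]
  exact ZMod.not_isSquare_of_isSquare_neg hl4 (ZMod.prime_ne_zero ℓ p hne) hsq
end

section
/- Let p and ℓ be primes with p ≡ 1 (mod 4), ℓ ≡ 3 (mod 4), and −p a square in ℤ/ℓℤ. Then 4 divides p + ℓ, and the Diophantine equation p·x² + p·x·y + ((p+ℓ)/4)·y² = z² has no integer solutions (x, y, z) other than x = y = z = 0. -/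
/-- If `-a` is a nonzero square modulo a prime `ℓ ≡ 3 (mod 4)`, then `a X² = Z²` has only the
trivial solution modulo `ℓ`. -/
theorem ZMod.eq_zero_of_mul_sq_eq_sq {ℓ : ℕ} [Fact ℓ.Prime] (hl4 : ℓ % 4 = 3) {a X Z : ZMod ℓ}
    (ha : a ≠ 0) (hsq : IsSquare (-a)) (h : a * X ^ 2 = Z ^ 2) : X = 0 ∧ Z = 0 := by
  have hX : X = 0 := by
    by_contra hX
    have hZ : Z ≠ 0 := by
      rintro rfl
      simp_all
    obtain ⟨s, hs⟩ := hsq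
    refine ZMod.exists_sq_eq_neg_one_iff.mp ⟨s * X / Z, ?_⟩ hl4
    field_simp
    linear_combination X ^ 2 * hs + h
  subst hX
  exact ⟨rfl, by simpa [eq_comm] using h⟩

/-- If `-a` is a nonzero square modulo a prime `ℓ ≡ 3 (mod 4)`, then `a X² + ℓ Y² = Z²` has only
the trivial integer solution. -/
theorem Int.eq_zero_of_mul_sq_add_prime_mul_sq_eq_sq {ℓ : ℕ} [Fact ℓ.Prime] (hl4 : ℓ % 4 = 3)
    {a : ℤ} (ha : (a : ZMod ℓ) ≠ 0) (hsq : IsSquare (-(a : ZMod ℓ))) (X Y Z : ℤ)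
    (h : a * X ^ 2 + ℓ * Y ^ 2 = Z ^ 2) : X = 0 ∧ Y = 0 ∧ Z = 0 := by
  have hl : ℓ.Prime := Fact.out
  have hl0 : (ℓ : ℤ) ≠ 0 := by exact_mod_cast hl.ne_zero
  induction hn : X.natAbs + Y.natAbs + Z.natAbs using Nat.strong_induction_on
    generalizing X Y Z with
  | _ n ih =>
    have hmod : (a : ZMod ℓ) * (X : ZMod ℓ) ^ 2 = (Z : ZMod ℓ) ^ 2 := by
      simpa using congrArg (Int.cast : ℤ → ZMod ℓ) h
    obtain ⟨hX, hZ⟩ := ZMod.eq_zero_of_mul_sq_eq_sq hl4 ha hsq hmod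
    obtain ⟨X', rfl⟩ := (ZMod.intCast_zmod_eq_zero_iff_dvd X ℓ).mp hX
    obtain ⟨Z', rfl⟩ := (ZMod.intCast_zmod_eq_zero_iff_dvd Z ℓ).mp hZ
    have hY : (ℓ : ℤ) ∣ Y := by
      refine (Nat.prime_iff_prime_int.mp hl).dvd_of_dvd_pow (n := 2) ⟨Z' ^ 2 - a * X' ^ 2, ?_⟩
      apply mul_left_cancel₀ hl0
      linear_combination h
    obtain ⟨Y', rfl⟩ := hY
    have h' : a * X' ^ 2 + ℓ * Y' ^ 2 = Z' ^ 2 := by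
      apply mul_left_cancel₀ (pow_ne_zero 2 hl0)
      linear_combination h
    simp only [Int.natAbs_mul, Int.natAbs_natCast, ← mul_add] at hn
    rcases Nat.eq_zero_or_pos (X'.natAbs + Y'.natAbs + Z'.natAbs) with h0 | h0
    · have hX0 : X' = 0 := by omega
      have hY0 : Y' = 0 := by omega
      have hZ0 : Z' = 0 := by omega
      simp [hX0, hY0, hZ0]
    · obtain ⟨hX0, hY0, hZ0⟩ := ih _ (by nlinarith [hl.two_le]) X' Y' Z' h' rfl
      simp [hX0, hY0, hZ0]

theorem stmt_4 (p ℓ : ℕ) (hp : p.Prime) (hl : ℓ.Prime)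
    (hp4 : p % 4 = 1) (hl4 : ℓ % 4 = 3)
    (hsq : IsSquare (-(p : ZMod ℓ))) :
    4 ∣ p + ℓ ∧
    ∀ x y z : ℤ,
      (p : ℤ) * x ^ 2 + (p : ℤ) * x * y + (((p : ℤ) + ℓ) / 4) * y ^ 2 = z ^ 2 →
      x = 0 ∧ y = 0 ∧ z = 0 := by
  have : Fact ℓ.Prime := ⟨hl⟩
  refine ⟨by omega, fun x y z h => ?_⟩
  have hp0 : ((p : ℤ) : ZMod ℓ) ≠ 0 := by
    rw [Int.cast_natCast, Ne, ZMod.natCast_eq_zero_iff, Nat.prime_dvd_prime_iff_eq hl hp]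
    omega
  have hdiv : 4 * (((p : ℤ) + ℓ) / 4) = p + ℓ := by omega
  obtain ⟨hX, hY, hZ⟩ := Int.eq_zero_of_mul_sq_add_prime_mul_sq_eq_sq hl4 hp0
    (by simpa using hsq) (2 * x + y) y (2 * z) (by linear_combination 4 * h - y ^ 2 * hdiv)
  omega
end

section
/- Let P be a monic polynomial with integer coefficients whose degree is even, and let q be a rational number. Then the denominator (in lowest terms) of the rational number P(q) equals den(q)^deg(P); in particular, the denominator of P(q) is a perfect square. -/
open Polynomial in
/-- Modulo `s`, scaling the roots of a monic polynomial by `s` leaves only the leading term. -/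
lemma Polynomial.Monic.dvd_eval_scaleRoots_sub_pow {R : Type*} [CommRing R] {p : R[X]}
    (hp : p.Monic) (r s : R) : s ∣ (p.scaleRoots s).eval r - r ^ p.natDegree := by
  rw [eval_eq_sum_range, natDegree_scaleRoots, Finset.sum_range_succ,
    coeff_scaleRoots_natDegree, hp.leadingCoeff, one_mul, add_sub_cancel_right]
  refine Finset.dvd_sum fun i hi => ?_
  rw [coeff_scaleRoots]
  exact ((dvd_pow_self s (Nat.sub_ne_zero_of_lt (Finset.mem_range.1 hi))).mul_left _).mul_right _

open Polynomial in
lemma Polynomial.Monic.isCoprime_eval_scaleRoots {R : Type*} [CommRing R] {p : R[X]}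
    (hp : p.Monic) {r s : R} (h : IsCoprime r s) : IsCoprime ((p.scaleRoots s).eval r) s := by
  obtain ⟨c, hc⟩ := hp.dvd_eval_scaleRoots_sub_pow r s
  rw [sub_eq_iff_eq_add'] at hc
  rw [hc]
  exact h.pow_left.add_mul_left_left c

open Polynomial in
lemma Polynomial.Monic.den_aeval_rat {p : ℤ[X]} (hp : p.Monic) (q : ℚ) :
    (aeval q p).den = q.den ^ p.natDegree := by
  have hcop : IsCoprime ((p.scaleRoots q.den).eval q.num) ((q.den : ℤ) ^ p.natDegree) :=
    (hp.isCoprime_eval_scaleRoots q.isCoprime_num_den).pow_right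
  have heval : aeval q p =
      (((p.scaleRoots q.den).eval q.num : ℤ) : ℚ) / (((q.den : ℤ) ^ p.natDegree : ℤ) : ℚ) := by
    have h := scaleRoots_eval₂_mul (p := p) (Int.castRingHom ℚ) q (q.den : ℤ)
    have hnum : (Int.castRingHom ℚ) (q.den : ℤ) * q = Int.castRingHom ℚ q.num := by
      simp [Rat.den_mul_eq_num]
    rw [hnum, eval₂_at_apply] at h
    rw [eq_div_iff (by simp), mul_comm]
    simpa [aeval_def] using h.symm
  have hpos : 0 < (q.den : ℤ) ^ p.natDegree := by positivity
  have hden := Rat.den_div_eq_of_coprime hpos (Int.isCoprime_iff_nat_coprime.1 hcop)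
  rw [← heval] at hden
  exact_mod_cast hden

theorem stmt_7 (P : Polynomial ℤ) (hmonic : P.Monic) (heven : Even P.natDegree)
    (q : ℚ) :
    ((Polynomial.aeval q) P).den = q.den ^ P.natDegree ∧
    IsSquare ((Polynomial.aeval q) P).den := by
  rw [hmonic.den_aeval_rat q]
  exact ⟨rfl, heven.isSquare_pow _⟩
end

section
/- Let p be a prime with p ≡ 3 (mod 4), and let (c, d) be the fundamental solution of the Pell equation c² − p·d² = 1, i.e., c and d are positive integers with c² − p·d² = 1 and d is minimal among all positive integer solutions. Then c is even and d is odd. -/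
theorem Int.exists_pos_sq_of_isCoprime_of_mul_eq_sq {a b c : ℤ} (ha : 0 < a)
    (h : IsCoprime a b) (heq : a * b = c ^ 2) : ∃ r : ℤ, 0 < r ∧ a = r ^ 2 := by
  obtain ⟨r, hr | hr⟩ := Int.sq_of_isCoprime h heq
  · have hr0 : r ≠ 0 := by
      rintro rfl
      simp [hr] at ha
    exact ⟨|r|, abs_pos.mpr hr0, by rw [sq_abs, hr]⟩
  · nlinarith [sq_nonneg r]

/-- For `p ≡ 3 (mod 4)`, the negative Pell equation has no solution. -/
theorem Int.sq_add_one_ne_mul_sq {p : ℤ} (hp4 : p % 4 = 3) (a b : ℤ) :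
    a ^ 2 + 1 ≠ p * b ^ 2 := by
  intro h
  have h4 : (a ^ 2 + 1) % 4 = (3 * b ^ 2) % 4 := by
    rw [h, Int.mul_emod, hp4]
    simp [Int.mul_emod]
  rcases Int.even_or_odd' a with ⟨x, rfl | rfl⟩ <;>
  rcases Int.even_or_odd' b with ⟨y, rfl | rfl⟩ <;>
  ring_nf at h4 <;> omega

/-- A solution of the Pell equation with odd first coordinate comes from a solution with
smaller second coordinate. -/
theorem Int.exists_smaller_pell_of_odd {p : ℤ} (hp : Prime p) (hp0 : 0 < p) (hp4 : p % 4 = 3)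
    {c d : ℤ} (hc : 0 < c) (hd : 0 < d) (hpell : c ^ 2 - p * d ^ 2 = 1) (hodd : Odd c) :
    ∃ c' d' : ℤ, 0 < c' ∧ 0 < d' ∧ c' ^ 2 - p * d' ^ 2 = 1 ∧ d' < d := by
  have hpodd : Odd p := Int.odd_iff.mpr (by omega)
  have hdeven : Even d := by
    have h : Even (p * d ^ 2) := by
      rw [show p * d ^ 2 = c ^ 2 - 1 by linarith]
      exact hodd.pow.sub_odd odd_one
    by_contra hd'
    exact Int.not_even_iff_odd.mpr (hpodd.mul (Int.not_even_iff_odd.mp hd').pow) h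
  obtain ⟨k, rfl⟩ := hodd
  obtain ⟨e, rfl⟩ := hdeven.exists_two_nsmul
  simp only [nsmul_eq_mul, Nat.cast_ofNat] at *
  have he : 0 < e := by omega
  have hk : k * (k + 1) = p * e ^ 2 := by linarith
  have hkpos : 0 < k := by
    have : 0 < k * (k + 1) := hk ▸ by positivity
    nlinarith
  have hcop : IsCoprime k (k + 1) := ⟨-1, 1, by ring⟩
  rcases hp.dvd_or_dvd (Dvd.intro _ hk.symm) with ⟨m, hm⟩ | ⟨m, hm⟩
  · have hme : m * (k + 1) = e ^ 2 :=
      mul_left_cancel₀ hp.ne_zero (by rw [← hk, ← mul_assoc, ← hm])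
    have hmpos : 0 < m := by
      rw [hm] at hkpos
      exact pos_of_mul_pos_right hkpos hp0.le
    have hcop' : IsCoprime m (k + 1) := hcop.of_isCoprime_of_dvd_left ⟨p, by rw [hm, mul_comm]⟩
    obtain ⟨a, ha, ham⟩ := exists_pos_sq_of_isCoprime_of_mul_eq_sq hmpos hcop' hme
    obtain ⟨b, hb, hbk⟩ := exists_pos_sq_of_isCoprime_of_mul_eq_sq (by omega) hcop'.symm
      (by rw [mul_comm, hme])
    refine ⟨b, a, hb, ha, by rw [← hbk, ← ham, ← hm]; ring, ?_⟩
    have hae : a ≤ e := by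
      refine le_of_sq_le_sq ?_ he.le
      nlinarith
    omega
  · have hme : k * m = e ^ 2 :=
      mul_left_cancel₀ hp.ne_zero (by rw [← hk, hm]; ring)
    have hmpos : 0 < m := by
      have : 0 < p * m := by omega
      exact pos_of_mul_pos_right this hp0.le
    have hcop' : IsCoprime k m := hcop.of_isCoprime_of_dvd_right ⟨p, by rw [hm, mul_comm]⟩
    obtain ⟨a, -, hak⟩ := exists_pos_sq_of_isCoprime_of_mul_eq_sq hkpos hcop' hme
    obtain ⟨b, -, hbm⟩ := exists_pos_sq_of_isCoprime_of_mul_eq_sq hmpos hcop'.symm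
      (by rw [mul_comm, hme])
    exact absurd (by rw [← hak, ← hbm, hm]) (sq_add_one_ne_mul_sq hp4 a b)

theorem stmt_8 (p : ℕ) (hp : p.Prime) (hp4 : p % 4 = 3)
    (c d : ℤ) (hc : 0 < c) (hd : 0 < d) (hpell : c ^ 2 - (p : ℤ) * d ^ 2 = 1)
    (hmin : ∀ c' d' : ℤ, 0 < c' → 0 < d' →
      c' ^ 2 - (p : ℤ) * d' ^ 2 = 1 → d ≤ d') :
    Even c ∧ Odd d := by
  have hceven : Even c := by
    by_contra hodd
    obtain ⟨c', d', hc', hd', h, hlt⟩ := Int.exists_smaller_pell_of_odd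
      (Nat.prime_iff_prime_int.mp hp) (mod_cast hp.pos) (by omega) hc hd hpell
      (Int.not_even_iff_odd.mp hodd)
    exact (hmin c' d' hc' hd' h).not_gt hlt
  refine ⟨hceven, Int.not_even_iff_odd.mp fun hdeven => ?_⟩
  have h : Even (c ^ 2 - (p : ℤ) * d ^ 2) :=
    (hceven.pow_of_ne_zero two_ne_zero).sub ((hdeven.pow_of_ne_zero two_ne_zero).mul_left _)
  rw [hpell] at h
  exact Int.not_even_one h
end

section
/- Let p be one of the primes 3, 7, 11, 19, and let ℓ be a prime with ℓ ≡ 1 (mod 4) such that p is a square in ℤ/ℓℤ (i.e., ℓ splits in ℚ(√p)). Then there exist integers A and B with A odd and ℓ = A² − p·B², and there also exist integers A and B with A even and ℓ = A² − p·B². -/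
/-- Thue's lemma in rectangular form. -/
theorem exists_small_modEq (ℓ X Y : ℕ) [NeZero ℓ] (r : ZMod ℓ) (h : ℓ < X * Y) :
    ∃ x y : ℤ, (x ≠ 0 ∨ y ≠ 0) ∧ |x| < X ∧ |y| < Y ∧ (x : ZMod ℓ) = r * y := by
  obtain ⟨a, ha, b, hb, hne, hab⟩ := Finset.exists_ne_map_eq_of_card_lt_of_maps_to
    (s := Finset.range X ×ˢ Finset.range Y) (t := (Finset.univ : Finset (ZMod ℓ)))
    (f := fun q => (q.1 : ZMod ℓ) - r * q.2)
    (by simpa [ZMod.card] using h) (fun _ _ => by simp)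
  simp only [Finset.mem_product, Finset.mem_range] at ha hb
  refine ⟨a.1 - b.1, a.2 - b.2, ?_, ?_, ?_, ?_⟩
  · by_contra! hc
    exact hne (Prod.ext (by omega) (by omega))
  · rw [abs_lt]; constructor <;> omega
  · rw [abs_lt]; constructor <;> omega
  · push_cast
    linear_combination hab

/-- If `p` is a square modulo `ℓ`, the form `x ^ 2 - p * y ^ 2` represents a multiple `k * ℓ`
with `|k| ≤ √p`. -/
theorem exists_small_multiple (p ℓ c : ℕ) (hp : 0 < p) (hl : 0 < ℓ) (hc : p < c ^ 2)
    (hsq : IsSquare (p : ZMod ℓ)) :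
    ∃ x y k : ℤ, (x ≠ 0 ∨ y ≠ 0) ∧ |k| < c ∧ x ^ 2 - p * y ^ 2 = k * ℓ := by
  obtain ⟨r, hr⟩ := hsq
  have : NeZero ℓ := ⟨hl.ne'⟩
  have hl' : (0 : ℝ) < ℓ := by exact_mod_cast hl
  have hs : 0 < √(p : ℝ) := Real.sqrt_pos.2 (by exact_mod_cast hp)
  have hs2 : √(p : ℝ) ^ 2 = p := Real.sq_sqrt (by positivity)
  have hsc : √(p : ℝ) < c := by
    rw [Real.sqrt_lt' (by
      rcases Nat.eq_zero_or_pos c with rfl | h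
      · simp at hc
      · exact_mod_cast h)]
    exact_mod_cast hc
  set s := √(p : ℝ)
  have hu := Nat.lt_floor_add_one √(s * ℓ)
  have hv := Nat.lt_floor_add_one √(ℓ / s)
  have huv : √(s * ℓ) * √(ℓ / s) = ℓ := by
    rw [← Real.sqrt_mul (by positivity), show s * ℓ * (ℓ / s) = (ℓ : ℝ) ^ 2 by field_simp,
      Real.sqrt_sq hl'.le]
  obtain ⟨x, y, hne, hx, hy, hxy⟩ := exists_small_modEq ℓ (⌊√(s * ℓ)⌋₊ + 1) (⌊√(ℓ / s)⌋₊ + 1) r (by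
    have := mul_lt_mul'' hu hv (by positivity) (by positivity)
    rw [huv] at this
    exact_mod_cast this)
  have hdvd : (ℓ : ℤ) ∣ x ^ 2 - p * y ^ 2 := by
    rw [← ZMod.intCast_zmod_eq_zero_iff_dvd]
    push_cast
    rw [hxy, hr]
    ring
  obtain ⟨k, hk⟩ := hdvd
  refine ⟨x, y, k, hne, ?_, by rw [hk]; ring⟩
  have sq_le (z : ℤ) (w : ℝ) (hw : 0 ≤ w) (h : |z| < (⌊√w⌋₊ + 1 : ℕ)) : (z : ℝ) ^ 2 ≤ w := by
    have h1 : |z| ≤ (⌊√w⌋₊ : ℤ) := by push_cast at h ⊢; omega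
    have h2 : |(z : ℝ)| ≤ (⌊√w⌋₊ : ℝ) := by exact_mod_cast h1
    have h3 := h2.trans (Nat.floor_le (Real.sqrt_nonneg w))
    rw [← sq_abs, ← Real.sq_sqrt hw]
    exact pow_le_pow_left₀ (abs_nonneg _) h3 2
  have hx2 := sq_le x _ (by positivity) hx
  have hy2 := sq_le y _ (by positivity) hy
  have hpy : (p : ℝ) * y ^ 2 ≤ s * ℓ := by
    calc (p : ℝ) * y ^ 2 ≤ p * (ℓ / s) := by gcongr
      _ = s * ℓ := by rw [← hs2]; field_simp
  have hk' : (x : ℝ) ^ 2 - p * y ^ 2 = ℓ * k := by exact_mod_cast hk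
  have hlk : ℓ * |(k : ℝ)| ≤ ℓ * s := by
    rw [← abs_of_pos hl', ← abs_mul, ← hk', abs_of_pos hl', abs_le]
    have : 0 ≤ (p : ℝ) * y ^ 2 := by positivity
    constructor <;> nlinarith [sq_nonneg (x : ℝ)]
  have := (le_of_mul_le_mul_left hlk hl').trans_lt hsc
  exact_mod_cast this

theorem eq_zero_of_sq_eq_mul_sq {p : ℤ} (hp : ¬ IsSquare p) {x y : ℤ}
    (h : x ^ 2 - p * y ^ 2 = 0) : x = 0 ∧ y = 0 := by
  have hd : y ∣ x := by
    rw [← Int.pow_dvd_pow_iff two_ne_zero]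
    exact ⟨p, by linear_combination h⟩
  obtain ⟨z, rfl⟩ := hd
  have hy : y = 0 := by
    by_contra hy
    refine hp ⟨z, ?_⟩
    have : y ^ 2 * (z * z - p) = 0 := by linear_combination h
    rcases mul_eq_zero.1 this with h' | h'
    · exact absurd (pow_eq_zero_iff two_ne_zero |>.1 h') hy
    · omega
  simp [hy]

/-- For `p ≡ 3 [ZMOD 4]` and `n ≡ 1 [ZMOD 4]`, the value `-n` is not represented, and a unit of
norm one with even rational part exchanges the parities of `A` in a representation of `n`. -/
theorem both_parities_of_unit {p n a b x y : ℤ} (hp : p % 4 = 3) (hn : n % 4 = 1)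
    (hab : a ^ 2 - p * b ^ 2 = 1) (ha : Even a)
    (h : x ^ 2 - p * y ^ 2 = n ∨ x ^ 2 - p * y ^ 2 = -n) :
    (∃ A B : ℤ, Odd A ∧ n = A ^ 2 - p * B ^ 2) ∧
    (∃ A B : ℤ, Even A ∧ n = A ^ 2 - p * B ^ 2) := by
  obtain ⟨q, rfl⟩ : ∃ q, p = 4 * q + 3 := ⟨p / 4, by omega⟩
  have hmod : ∀ z : ℤ, (Even z ∧ ∃ t, z ^ 2 = 4 * t) ∨ (Odd z ∧ ∃ t, z ^ 2 = 4 * t + 1) := by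
    intro z
    rcases Int.even_or_odd' z with ⟨t, rfl | rfl⟩
    · exact .inl ⟨by simp, t ^ 2, by ring⟩
    · exact .inr ⟨⟨t, rfl⟩, t ^ 2 + t, by ring⟩
  have hb : Odd b := by
    rw [← Int.not_even_iff_odd]
    intro hb
    obtain ⟨s, rfl⟩ := ha
    obtain ⟨t, rfl⟩ := hb
    ring_nf at hab
    omega
  have key : x ^ 2 - (4 * q + 3) * y ^ 2 = n ∧ ((Odd x ∧ Even y) ∨ (Even x ∧ Odd y)) := by
    have e : x ^ 2 - (4 * q + 3) * y ^ 2 = x ^ 2 + y ^ 2 - 4 * ((q + 1) * y ^ 2) := by ring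
    rw [e] at h ⊢
    generalize (q + 1) * y ^ 2 = w at h ⊢
    rcases hmod x with ⟨hx, s, hs⟩ | ⟨hx, s, hs⟩ <;> rcases hmod y with ⟨hy, t, ht⟩ | ⟨hy, t, ht⟩ <;>
      rw [hs, ht] at h ⊢
    · omega
    · exact ⟨by omega, .inr ⟨hx, hy⟩⟩
    · exact ⟨by omega, .inl ⟨hx, hy⟩⟩
    · omega
  obtain ⟨hN, hpar⟩ := key
  have hN' : n = (a * x + (4 * q + 3) * b * y) ^ 2 - (4 * q + 3) * (a * y + b * x) ^ 2 := by
    linear_combination -hN - (x ^ 2 - (4 * q + 3) * y ^ 2) * hab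
  have hq : Odd (4 * q + 3) := ⟨2 * q + 1, by ring⟩
  rcases hpar with ⟨hx, hy⟩ | ⟨hx, hy⟩
  · exact ⟨⟨x, y, hx, hN.symm⟩, _, _, (ha.mul_right x).add (hy.mul_left _), hN'⟩
  · exact ⟨⟨_, _, (ha.mul_right x).add_odd ((hq.mul hb).mul hy), hN'⟩, x, y, hx, hN.symm⟩

/-- An element of norm `±2` divides every element of norm `2 * n`, for odd `p`, `a`, `b`. -/
theorem exists_of_two_mul {p n a b x y : ℤ} (hp : Odd p) (ha : Odd a) (hb : Odd b)
    (hab : a ^ 2 - p * b ^ 2 = 2 ∨ a ^ 2 - p * b ^ 2 = -2) (h : x ^ 2 - p * y ^ 2 = 2 * n) :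
    ∃ A B : ℤ, A ^ 2 - p * B ^ 2 = n ∨ A ^ 2 - p * B ^ 2 = -n := by
  have hxy : Even (x + y) := by
    have : Even (x ^ 2 - p * y ^ 2) := ⟨n, by rw [h]; ring⟩
    simpa [Int.even_sub, Int.even_add, Int.even_mul, Int.even_pow, Int.not_even_iff_odd.2 hp]
      using this
  have hA : Even (a * x + p * b * y) := by
    simpa [Int.even_add, Int.even_mul, Int.not_even_iff_odd.2, hp, ha, hb] using hxy
  have hB : Even (a * y + b * x) := by
    rw [add_comm] at hxy
    simpa [Int.even_add, Int.even_mul, Int.not_even_iff_odd.2, ha, hb] using hxy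
  obtain ⟨A, hA⟩ := hA
  obtain ⟨B, hB⟩ := hB
  have e : 4 * (A ^ 2 - p * B ^ 2) = (a ^ 2 - p * b ^ 2) * (2 * n) := by
    rw [← h]
    linear_combination -(a * x + p * b * y + 2 * A) * hA + p * (a * y + b * x + 2 * B) * hB
  refine ⟨A, B, ?_⟩
  rcases hab with hab | hab <;> rw [hab] at e <;> omega

theorem exists_of_four_mul {p n x y : ℤ} (hp : p % 4 = 3) (h : x ^ 2 - p * y ^ 2 = 4 * n) :
    ∃ A B : ℤ, A ^ 2 - p * B ^ 2 = n := by
  obtain ⟨q, rfl⟩ : ∃ q, p = 4 * q + 3 := ⟨p / 4, by omega⟩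
  rcases Int.even_or_odd' x with ⟨s, rfl | rfl⟩ <;> rcases Int.even_or_odd' y with ⟨t, rfl | rfl⟩
  · exact ⟨s, t, by linarith⟩
  all_goals ring_nf at h; omega

/-- No `3 * n` with `3 ∤ n` is represented when `p ≡ 2 [ZMOD 3]`. -/
theorem three_dvd_of_three_mul {p n x y : ℤ} (hp : p % 3 = 2) (h : x ^ 2 - p * y ^ 2 = 3 * n) :
    3 ∣ n := by
  obtain ⟨q, rfl⟩ : ∃ q, p = 3 * q + 2 := ⟨p / 3, by omega⟩
  have hmod : ∀ z : ℤ, ∃ t, z = 3 * t ∨ z = 3 * t + 1 ∨ z = 3 * t + 2 := fun z =>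
    ⟨z / 3, by omega⟩
  obtain ⟨s, rfl | rfl | rfl⟩ := hmod x <;> obtain ⟨t, rfl | rfl | rfl⟩ := hmod y
  · exact ⟨s ^ 2 - (3 * q + 2) * t ^ 2, by linarith⟩
  all_goals ring_nf at h; omega

/-- The elements `4 ± √19` of norm `-3` divide every element of `ℤ[√19]` of norm `3 * n`. -/
theorem exists_of_three_mul_nineteen {n x y : ℤ} (h : x ^ 2 - 19 * y ^ 2 = 3 * n) :
    ∃ A B : ℤ, A ^ 2 - 19 * B ^ 2 = -n := by
  have h3 : (3 : ℤ) ∣ (x + y) * (x - y) := ⟨n + 6 * y ^ 2, by linarith⟩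
  rcases Int.prime_three.dvd_or_dvd h3 with ⟨t, ht⟩ | ⟨t, ht⟩
  · obtain rfl : x = 3 * t - y := by omega
    exact ⟨4 * t + 5 * y, t + y, by linarith⟩
  · obtain rfl : x = 3 * t + y := by omega
    exact ⟨4 * t - 5 * y, y - t, by linarith⟩

theorem stmt_11 (p : ℕ) (hp : p = 3 ∨ p = 7 ∨ p = 11 ∨ p = 19)
    (ℓ : ℕ) (hl : ℓ.Prime) (hl4 : ℓ % 4 = 1)
    (hsq : IsSquare ((p : ZMod ℓ))) :
    (∃ A B : ℤ, Odd A ∧ (ℓ : ℤ) = A ^ 2 - (p : ℤ) * B ^ 2) ∧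
    (∃ A B : ℤ, Even A ∧ (ℓ : ℤ) = A ^ 2 - (p : ℤ) * B ^ 2) := by
  have hn : (ℓ : ℤ) % 4 = 1 := by omega
  have hl3 : ¬ (3 : ℤ) ∣ ℓ := by
    intro h
    have := (Nat.prime_dvd_prime_iff_eq Nat.prime_three hl).1 (by exact_mod_cast h)
    omega
  have hp4 : (p : ℤ) % 4 = 3 := by omega
  have hpo : Odd (p : ℤ) := by rw [Int.odd_iff]; omega
  have hns : ¬ IsSquare (p : ℤ) := by
    rintro ⟨z, hz⟩
    rcases Int.even_or_odd' z with ⟨t, rfl | rfl⟩ <;> ring_nf at hz <;> omega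
  obtain ⟨a, b, c, d, hab, ha, hcd, hc, hd⟩ : ∃ a b c d : ℤ, a ^ 2 - p * b ^ 2 = 1 ∧ Even a ∧
      (c ^ 2 - p * d ^ 2 = 2 ∨ c ^ 2 - p * d ^ 2 = -2) ∧ Odd c ∧ Odd d := by
    rcases hp with rfl | rfl | rfl | rfl
    · exact ⟨2, 1, 1, 1, by norm_num, by decide, by norm_num, by decide, by decide⟩
    · exact ⟨8, 3, 3, 1, by norm_num, by decide, by norm_num, by decide, by decide⟩
    · exact ⟨10, 3, 3, 1, by norm_num, by decide, by norm_num, by decide, by decide⟩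
    · exact ⟨170, 39, 13, 3, by norm_num, by decide, by norm_num, by decide, by decide⟩
  suffices h : ∃ x y : ℤ, x ^ 2 - p * y ^ 2 = ℓ ∨ x ^ 2 - p * y ^ 2 = -ℓ by
    obtain ⟨x, y, h⟩ := h
    exact both_parities_of_unit hp4 hn hab ha h
  obtain ⟨x, y, k, hne, hk, hxy, hk3⟩ : ∃ x y k : ℤ, (x ≠ 0 ∨ y ≠ 0) ∧ |k| < 5 ∧
      x ^ 2 - p * y ^ 2 = k * ℓ ∧ (|k| < 3 ∨ p = 11 ∧ |k| < 4 ∨ p = 19) := by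
    rcases hp with hp | hp | hp | hp
    · obtain ⟨x, y, k, hne, hk, h⟩ :=
        exists_small_multiple p ℓ 3 (by omega) hl.pos (by omega) hsq
      push_cast at hk
      exact ⟨x, y, k, hne, by omega, h, by omega⟩
    · obtain ⟨x, y, k, hne, hk, h⟩ :=
        exists_small_multiple p ℓ 3 (by omega) hl.pos (by omega) hsq
      push_cast at hk
      exact ⟨x, y, k, hne, by omega, h, by omega⟩
    · obtain ⟨x, y, k, hne, hk, h⟩ :=
        exists_small_multiple p ℓ 4 (by omega) hl.pos (by omega) hsq
      push_cast at hk
      exact ⟨x, y, k, hne, by omega, h, by omega⟩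
    · obtain ⟨x, y, k, hne, hk, h⟩ :=
        exists_small_multiple p ℓ 5 (by omega) hl.pos (by omega) hsq
      push_cast at hk
      exact ⟨x, y, k, hne, by omega, h, by omega⟩
  obtain ⟨j, m, hj, hj5, hm, hjm⟩ : ∃ j m : ℤ, 0 ≤ j ∧ j = |k| ∧ (m = ℓ ∨ m = -ℓ) ∧
      x ^ 2 - p * y ^ 2 = j * m := by
    rcases abs_cases k with ⟨h, -⟩ | ⟨h, -⟩
    · exact ⟨|k|, ℓ, abs_nonneg k, rfl, .inl rfl, by rw [h, hxy]⟩
    · exact ⟨|k|, -ℓ, abs_nonneg k, rfl, .inr rfl, by rw [h, hxy]; ring⟩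
  rw [← hj5] at hk hk3
  interval_cases j
  · have := eq_zero_of_sq_eq_mul_sq hns (hjm.trans (zero_mul m))
    omega
  · exact ⟨x, y, by omega⟩
  · obtain ⟨A, B, h⟩ := exists_of_two_mul hpo hc hd hcd hjm
    exact ⟨A, B, by omega⟩
  · obtain rfl | rfl : p = 11 ∨ p = 19 := by omega
    · have := three_dvd_of_three_mul (by norm_num) hjm
      omega
    · obtain ⟨A, B, h⟩ := exists_of_three_mul_nineteen hjm
      push_cast
      exact ⟨A, B, by omega⟩
  · obtain ⟨A, B, h⟩ := exists_of_four_mul hp4 hjm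
    exact ⟨A, B, by omega⟩
end
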